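/- Let N ≥ 1 be an integer, p > 1, ρ(y) = exp(|y|²/4), and let v : ℝ^N × (0,∞) → ℝ be a smooth solution of the rescaled equation ∂_s v = Δv + (y/2)·∇v + v/(p−1) + v^p. Assume that for every s > 0 the functions v(·,s), |∇v(·,s)|, ∂_s v(·,s) belong to L²_ρ and v(·,s) ∈ L^{p+1}_ρ, that the map s ↦ g(s) = (1/2)∫_{ℝ^N}v(y,s)²ρ(y) dy is differentiable with g′(s) = ∫_{ℝ^N} v(·,s)·∂_s v(·,s) ρ dy, and that integration by parts is valid: ∫_{ℝ^N} v(·,s)·(Δv(·,s) + (y/2)·∇v(·,s)) ρ dy = −∫_{ℝ^N}|∇v(·,s)|²ρ dy for every s > 0. Then for every s > 0, ((p−1)N/2 − 2)·g(s) ≤ (1/2)·I(s) + (p+1)·E(v(·,s)), where I(s) = ∫_{ℝ^N}(∂_s v(y,s))²ρ(y) dy. -/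

import Mathlib

open MeasureTheory Real
open scoped InnerProductSpace

noncomputable def rho {N : ℕ} (y : EuclideanSpace ℝ (Fin N)) : ℝ := Real.exp (‖y‖ ^ 2 / 4)

/-- The Laplacian of `f : ℝ^N → ℝ`: `Δf = ∑ i, ∂²f/∂yᵢ²`. -/
noncomputable def lap {N : ℕ} (f : EuclideanSpace ℝ (Fin N) → ℝ)
    (x : EuclideanSpace ℝ (Fin N)) : ℝ :=
  ∑ i : Fin N, fderiv ℝ (fun z => fderiv ℝ f z (EuclideanSpace.single i 1)) x
    (EuclideanSpace.single i 1)

/-- The operator `Lw = -Δw - (y/2)·∇w`. -/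
noncomputable def Lop {N : ℕ} (w : EuclideanSpace ℝ (Fin N) → ℝ)
    (y : EuclideanSpace ℝ (Fin N)) : ℝ :=
  - lap w y - (1/2) * ⟪y, gradient w y⟫_ℝ

/-- The entropy functional `E(w) = ∫ [½|∇w|² - w²/(2(p-1)) - w^{p+1}/(p+1)] ρ dy`. -/
noncomputable def entropy {N : ℕ} (p : ℝ) (w : EuclideanSpace ℝ (Fin N) → ℝ) : ℝ :=
  ∫ y, ((1/2) * ‖gradient w y‖ ^ 2 - w y ^ 2 / (2 * (p - 1)) - w y ^ (p + 1) / (p + 1)) * rho y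

/-- `v` solves the rescaled equation `∂ₛv = Δv + (y/2)·∇v + v/(p-1) + vᵖ` for `s > 0`. -/
def IsRescaledSolution {N : ℕ} (p : ℝ) (v : ℝ → EuclideanSpace ℝ (Fin N) → ℝ) : Prop :=
  ∀ (y : EuclideanSpace ℝ (Fin N)) (s : ℝ), 0 < s →
    deriv (fun τ => v τ y) s =
      lap (v s) y + (1/2) * ⟪y, gradient (v s) y⟫_ℝ + v s y / (p - 1) + v s y ^ p

/-- The Wang bound `0 ≤ v(y,s) ≤ [(λ^{1-p}-1)(p-1)]^{-1/(p-1)}·[eˢ/(eˢ-1)]^{1/(p-1)}`. -/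
def WangBound {N : ℕ} (p lam : ℝ) (v : ℝ → EuclideanSpace ℝ (Fin N) → ℝ) : Prop :=
  ∀ (y : EuclideanSpace ℝ (Fin N)) (s : ℝ), 0 < s →
    0 ≤ v s y ∧ v s y ≤ ((lam ^ (1 - p) - 1) * (p - 1)) ^ (-(1 / (p - 1))) *
      (Real.exp s / (Real.exp s - 1)) ^ (1 / (p - 1))

/-- The bounded approximation `t / (2 (1 + ε t²))` of `t / 2`. -/
noncomputable def cutoffHalf (ε t : ℝ) : ℝ := t / (2 * (1 + ε * t ^ 2))

/-- The derivative of `cutoffHalf ε`. -/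
noncomputable def cutoffHalfDeriv (ε t : ℝ) : ℝ :=
  (1 - ε * t ^ 2) / (2 * (1 + ε * t ^ 2) ^ 2)

lemma hasDerivAt_cutoffHalf {ε : ℝ} (hε : 0 < ε) (t : ℝ) :
    HasDerivAt (cutoffHalf ε) (cutoffHalfDeriv ε t) t := by
  have h0 : (1 + ε * t ^ 2) ≠ 0 := by positivity
  have h1 : HasDerivAt (fun t : ℝ => 2 * (1 + ε * t ^ 2)) (2 * (ε * (2 * t))) t := by
    simpa using ((((hasDerivAt_pow 2 t).const_mul ε).const_add 1).const_mul 2)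
  have h2 := (hasDerivAt_id t).div h1 (by positivity)
  convert! h2 using 1
  simp only [cutoffHalfDeriv, id]
  field_simp
  ring

lemma continuous_cutoffHalf {ε : ℝ} (hε : 0 < ε) : Continuous (cutoffHalf ε) :=
  continuous_iff_continuousAt.2 fun t => (hasDerivAt_cutoffHalf hε t).continuousAt

lemma continuous_cutoffHalfDeriv {ε : ℝ} (hε : 0 < ε) : Continuous (cutoffHalfDeriv ε) := by
  unfold cutoffHalfDeriv
  refine Continuous.div (by fun_prop) (by fun_prop) fun t => ?_
  positivity

lemma abs_cutoffHalf_le {ε : ℝ} (hε : 0 < ε) (t : ℝ) : |cutoffHalf ε t| ≤ 1 + 1 / ε := by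
  have h0 : 0 < 2 * (1 + ε * t ^ 2) := by positivity
  rw [cutoffHalf, abs_div, abs_of_pos h0, div_le_iff₀ h0]
  have h1 : (1 + 1 / ε) * (2 * (1 + ε * t ^ 2)) = 2 * (1 + ε * t ^ 2 + 1 / ε + t ^ 2) := by
    field_simp
    ring
  rw [h1]
  have h2 : 0 < 1 / ε := by positivity
  have h3 : 0 ≤ ε * t ^ 2 := by positivity
  nlinarith [sq_nonneg (|t| - 1), sq_abs t]

lemma sq_cutoffHalf_le {ε : ℝ} (hε : 0 < ε) (t : ℝ) :
    cutoffHalf ε t ^ 2 ≤ cutoffHalf ε t * (t / 2) := by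
  have h0 : 0 < 1 + ε * t ^ 2 := by positivity
  have h1 : cutoffHalf ε t * (t / 2) - cutoffHalf ε t ^ 2
      = t ^ 2 * (ε * t ^ 2) / (4 * (1 + ε * t ^ 2) ^ 2) := by
    rw [cutoffHalf]
    field_simp
    ring
  have h2 : 0 ≤ t ^ 2 * (ε * t ^ 2) / (4 * (1 + ε * t ^ 2) ^ 2) := by positivity
  linarith

lemma abs_cutoffHalf_mul_le {ε : ℝ} (hε : 0 < ε) (t : ℝ) :
    |cutoffHalf ε t * (t / 2)| ≤ 1 / ε := by
  rw [abs_of_nonneg ((sq_nonneg _).trans (sq_cutoffHalf_le hε t)), cutoffHalf, div_mul_div_comm,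
    div_le_div_iff₀ (by positivity) hε]
  have : 0 ≤ t ^ 2 * ε := by positivity
  nlinarith

lemma abs_cutoffHalfDeriv_le {ε : ℝ} (hε : 0 < ε) (t : ℝ) : |cutoffHalfDeriv ε t| ≤ 1 / 2 := by
  have h3 : 0 ≤ ε * t ^ 2 := by positivity
  rw [cutoffHalfDeriv, abs_div, abs_of_pos (a := 2 * (1 + ε * t ^ 2) ^ 2) (by positivity),
    div_le_div_iff₀ (by positivity) (by norm_num)]
  have : |1 - ε * t ^ 2| ≤ 1 + ε * t ^ 2 := abs_le.2 ⟨by linarith, by linarith⟩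
  nlinarith

lemma rho_pos {N : ℕ} (y : EuclideanSpace ℝ (Fin N)) : 0 < rho y := Real.exp_pos _

lemma continuous_rho {N : ℕ} : Continuous (rho (N := N)) := by
  unfold rho
  fun_prop

lemma hasLineDerivAt_rho {N : ℕ} (i : Fin N) (y : EuclideanSpace ℝ (Fin N)) :
    HasLineDerivAt ℝ rho (y i / 2 * rho y) y (EuclideanSpace.single i 1) := by
  have h := ((hasStrictFDerivAt_norm_sq y).hasFDerivAt.hasLineDerivAt
    (EuclideanSpace.single i (1 : ℝ)))
  have h2 := (HasDerivAt.div_const h 4).exp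
  unfold HasLineDerivAt
  convert! h2 using 1
  simp [rho, EuclideanSpace.inner_single_right]
  ring

/-- A product of two functions in `L²(ρ)` is in `L¹(ρ)`. -/
lemma integrable_mul_mul_rho {N : ℕ} {a b : EuclideanSpace ℝ (Fin N) → ℝ}
    (ha : Continuous a) (hb : Continuous b)
    (hai : Integrable (fun y => a y ^ 2 * rho y)) (hbi : Integrable (fun y => b y ^ 2 * rho y)) :
    Integrable (fun y => a y * b y * rho y) := by
  refine (hai.add hbi).mono' ((ha.mul hb).mul continuous_rho).aestronglyMeasurable
    (.of_forall fun y => ?_)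
  rw [Real.norm_eq_abs, abs_mul, abs_of_pos (rho_pos y), Pi.add_apply, ← add_mul]
  refine mul_le_mul_of_nonneg_right ?_ (rho_pos y).le
  rw [abs_le]
  constructor <;>
    nlinarith [sq_nonneg (a y + b y), sq_nonneg (a y - b y), sq_nonneg (a y), sq_nonneg (b y)]

/-- An approximate form of `half_integral_sq_le_integral_sq_fderiv`. -/
lemma integral_cutoffHalfDeriv_mul_le {N : ℕ} {w : EuclideanSpace ℝ (Fin N) → ℝ}
    (hw : ContDiff ℝ 1 w) (i : Fin N) (hwi : Integrable (fun y => w y ^ 2 * rho y))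
    (hDi : Integrable (fun y => (fderiv ℝ w y (EuclideanSpace.single i 1)) ^ 2 * rho y))
    {ε : ℝ} (hε : 0 < ε) :
    ∫ y, cutoffHalfDeriv ε (y i) * (w y ^ 2 * rho y)
      ≤ ∫ y, (fderiv ℝ w y (EuclideanSpace.single i 1)) ^ 2 * rho y := by
  set e : EuclideanSpace ℝ (Fin N) := EuclideanSpace.single i 1 with he
  have hwc : Continuous w := hw.continuous
  have hDc : Continuous fun y => fderiv ℝ w y e :=
    (hw.continuous_fderiv one_ne_zero).clm_apply continuous_const
  have hyc : Continuous fun y : EuclideanSpace ℝ (Fin N) => y i := by fun_prop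
  have hc := (continuous_cutoffHalf hε).comp hyc
  have hcd := (continuous_cutoffHalfDeriv hε).comp hyc
  have i1 : Integrable fun y => cutoffHalfDeriv ε (y i) * (w y ^ 2 * rho y) :=
    hwi.bdd_mul hcd.aestronglyMeasurable
      (.of_forall fun y => abs_cutoffHalfDeriv_le hε (y i))
  have i2 : Integrable fun y => cutoffHalf ε (y i) * (w y * fderiv ℝ w y e * rho y) :=
    (integrable_mul_mul_rho hwc hDc hwi hDi).bdd_mul hc.aestronglyMeasurable
      (.of_forall fun y => abs_cutoffHalf_le hε (y i))
  have i3 : Integrable fun y => cutoffHalf ε (y i) * (y i / 2) * (w y ^ 2 * rho y) :=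
    hwi.bdd_mul (hc.mul (hyc.div_const 2)).aestronglyMeasurable
      (.of_forall fun y => abs_cutoffHalf_mul_le hε (y i))
  have i0 : Integrable fun y => cutoffHalf ε (y i) * (w y ^ 2 * rho y) :=
    hwi.bdd_mul hc.aestronglyMeasurable
      (.of_forall fun y => abs_cutoffHalf_le hε (y i))
  have hder : ∀ y, HasLineDerivAt ℝ (fun y => cutoffHalf ε (y i) * (w y ^ 2 * rho y))
      (cutoffHalfDeriv ε (y i) * (w y ^ 2 * rho y)
        + 2 * (cutoffHalf ε (y i) * (w y * fderiv ℝ w y e * rho y))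
        + cutoffHalf ε (y i) * (y i / 2) * (w y ^ 2 * rho y)) y e := by
    intro y
    have d1 : HasDerivAt (fun t : ℝ => (y + t • e) i) 1 0 := by
      have : (fun t : ℝ => (y + t • e) i) = fun t => y i + t := by
        ext t
        simp [he]
      rw [this]
      exact (hasDerivAt_id (0 : ℝ)).const_add _
    have hy0 : y + (0 : ℝ) • e = y := by simp
    have d2 : HasDerivAt (fun t : ℝ => cutoffHalf ε ((y + t • e) i))
        (cutoffHalfDeriv ε (y i) * 1) 0 := by
      refine HasDerivAt.comp (0 : ℝ) (h₂ := cutoffHalf ε) ?_ d1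
      rw [hy0]
      exact hasDerivAt_cutoffHalf hε _
    have d3 : HasDerivAt (fun t : ℝ => w (y + t • e)) (fderiv ℝ w y e) 0 :=
      ((hw.differentiable one_ne_zero) y).hasFDerivAt.hasLineDerivAt e
    have d4 : HasDerivAt (fun t : ℝ => rho (y + t • e)) (y i / 2 * rho y) 0 :=
      hasLineDerivAt_rho i y
    have d := d2.mul ((d3.pow 2).mul d4)
    unfold HasLineDerivAt
    convert! d using 1
    simp
    ring
  have hzero : ∫ y, (cutoffHalfDeriv ε (y i) * (w y ^ 2 * rho y)
        + 2 * (cutoffHalf ε (y i) * (w y * fderiv ℝ w y e * rho y))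
        + cutoffHalf ε (y i) * (y i / 2) * (w y ^ 2 * rho y)) = 0 := by
    have := integral_bilinear_hasLineDerivAt_right_eq_neg_left_of_integrable
      (μ := (volume : Measure (EuclideanSpace ℝ (Fin N))))
      (f := fun _ => (1 : ℝ)) (f' := fun _ => 0) (v := e) (B := ContinuousLinearMap.mul ℝ ℝ)
      (g := fun y => cutoffHalf ε (y i) * (w y ^ 2 * rho y))
      (g' := fun y => cutoffHalfDeriv ε (y i) * (w y ^ 2 * rho y)
        + 2 * (cutoffHalf ε (y i) * (w y * fderiv ℝ w y e * rho y))
        + cutoffHalf ε (y i) * (y i / 2) * (w y ^ 2 * rho y))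
      (by simp) (by simpa using (i1.fun_add (i2.const_mul 2)).fun_add i3) (by simpa using i0)
      (fun x _ => (hasFDerivAt_const (1 : ℝ) x).hasLineDerivAt e) (fun x _ => hder x)
    simpa using this
  have hnonneg : 0 ≤ ∫ y, ((fderiv ℝ w y e) ^ 2 * rho y
      + (2 * (cutoffHalf ε (y i) * (w y * fderiv ℝ w y e * rho y))
        + cutoffHalf ε (y i) * (y i / 2) * (w y ^ 2 * rho y))) := by
    refine integral_nonneg fun y => ?_
    have h1 := mul_le_mul_of_nonneg_right (sq_cutoffHalf_le hε (y i)) (sq_nonneg (w y))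
    have h2 : 0 ≤ ((fderiv ℝ w y e) ^ 2 + 2 * (cutoffHalf ε (y i) * (w y * fderiv ℝ w y e))
        + cutoffHalf ε (y i) * (y i / 2) * w y ^ 2) * rho y := by
      refine mul_nonneg ?_ (rho_pos y).le
      nlinarith [sq_nonneg (fderiv ℝ w y e + cutoffHalf ε (y i) * w y)]
    simp only [Pi.zero_apply]
    linarith
  have i23 := (i2.const_mul 2).fun_add i3
  simp only [add_assoc] at hzero
  rw [integral_add hDi i23] at hnonneg
  rw [integral_add i1 i23] at hzero
  linarith

/-- A one-directional Poincaré inequality for the weight `ρ`. -/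
lemma half_integral_sq_le_integral_sq_fderiv {N : ℕ} {w : EuclideanSpace ℝ (Fin N) → ℝ}
    (hw : ContDiff ℝ 1 w) (i : Fin N) (hwi : Integrable (fun y => w y ^ 2 * rho y))
    (hDi : Integrable (fun y => (fderiv ℝ w y (EuclideanSpace.single i 1)) ^ 2 * rho y)) :
    (1 / 2) * ∫ y, w y ^ 2 * rho y
      ≤ ∫ y, (fderiv ℝ w y (EuclideanSpace.single i 1)) ^ 2 * rho y := by
  rw [← integral_const_mul]
  have hpos : ∀ n : ℕ, (0 : ℝ) < 1 / ((n : ℝ) + 1) := fun n => Nat.one_div_pos_of_nat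
  have hlim : Filter.Tendsto
      (fun n : ℕ => ∫ y, cutoffHalfDeriv (1 / ((n : ℝ) + 1)) (y i) * (w y ^ 2 * rho y))
      Filter.atTop (nhds (∫ y, 1 / 2 * (w y ^ 2 * rho y))) := by
    refine tendsto_integral_of_dominated_convergence (fun y => 1 / 2 * (w y ^ 2 * rho y))
      (fun n => ?_) (hwi.const_mul _) (fun n => .of_forall fun y => ?_) (.of_forall fun y => ?_)
    · have hyc : Continuous fun y : EuclideanSpace ℝ (Fin N) => y i := by fun_prop
      exact (((continuous_cutoffHalfDeriv (hpos n)).comp hyc).mul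
        ((hw.continuous.pow 2).mul continuous_rho)).aestronglyMeasurable
    · have h0 : 0 ≤ w y ^ 2 * rho y := mul_nonneg (sq_nonneg _) (rho_pos y).le
      rw [Real.norm_eq_abs, abs_mul, abs_of_nonneg h0]
      exact mul_le_mul_of_nonneg_right (abs_cutoffHalfDeriv_le (hpos n) _) h0
    · refine Filter.Tendsto.mul_const _ ?_
      have hc : ContinuousAt (fun ε : ℝ => cutoffHalfDeriv ε (y i)) 0 := by
        unfold cutoffHalfDeriv
        exact ContinuousAt.div (by fun_prop) (by fun_prop) (by simp)
      have := hc.tendsto.comp (tendsto_one_div_add_atTop_nhds_zero_nat (𝕜 := ℝ))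
      simpa [cutoffHalfDeriv, Function.comp_def] using this
  exact le_of_tendsto' hlim fun n => integral_cutoffHalfDeriv_mul_le hw i hwi hDi (hpos n)

lemma norm_sq_gradient_eq_sum {N : ℕ} (w : EuclideanSpace ℝ (Fin N) → ℝ)
    (y : EuclideanSpace ℝ (Fin N)) :
    ‖gradient w y‖ ^ 2 = ∑ i, (fderiv ℝ w y (EuclideanSpace.single i 1)) ^ 2 := by
  rw [EuclideanSpace.real_norm_sq_eq]
  refine Finset.sum_congr rfl fun i _ => ?_
  rw [← inner_gradient_left, EuclideanSpace.inner_single_right]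
  simp

/-- The Poincaré inequality for the weight `ρ`. -/
lemma integral_sq_le_integral_norm_sq_gradient {N : ℕ} {w : EuclideanSpace ℝ (Fin N) → ℝ}
    (hw : ContDiff ℝ 1 w) (hwi : Integrable (fun y => w y ^ 2 * rho y))
    (hDi : Integrable (fun y => ‖gradient w y‖ ^ 2 * rho y)) :
    (N : ℝ) * ((1 / 2) * ∫ y, w y ^ 2 * rho y) ≤ ∫ y, ‖gradient w y‖ ^ 2 * rho y := by
  have hi : ∀ i : Fin N,
      Integrable (fun y => (fderiv ℝ w y (EuclideanSpace.single i 1)) ^ 2 * rho y) := by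
    intro i
    have hDc : Continuous fun y => fderiv ℝ w y (EuclideanSpace.single i 1) :=
      (hw.continuous_fderiv one_ne_zero).clm_apply continuous_const
    refine hDi.mono' ((hDc.pow 2).mul continuous_rho).aestronglyMeasurable
      (.of_forall fun y => ?_)
    rw [Real.norm_of_nonneg (mul_nonneg (sq_nonneg _) (rho_pos y).le), norm_sq_gradient_eq_sum]
    exact mul_le_mul_of_nonneg_right
      (Finset.single_le_sum (f := fun i => (fderiv ℝ w y (EuclideanSpace.single i 1)) ^ 2)
        (fun j _ => sq_nonneg _) (Finset.mem_univ i)) (rho_pos y).le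
  simp only [norm_sq_gradient_eq_sum, Finset.sum_mul]
  rw [integral_finsetSum _ fun i _ => hi i]
  calc (N : ℝ) * ((1 / 2) * ∫ y, w y ^ 2 * rho y)
      = ∑ _i : Fin N, (1 / 2) * ∫ y, w y ^ 2 * rho y := by simp
    _ ≤ _ := Finset.sum_le_sum fun i _ =>
        half_integral_sq_le_integral_sq_fderiv hw i hwi (hi i)

lemma mul_rpow_self {p : ℝ} (hp : 1 < p) (x : ℝ) : x * x ^ p = x ^ (p + 1) := by
  rcases eq_or_ne x 0 with rfl | hx
  · rw [zero_mul, Real.zero_rpow (by linarith)]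
  · rw [Real.rpow_add_one hx, mul_comm]

/-- for a smooth solution of the rescaled equation with the stated
integrability, differentiability of `g(s) = ½∫v²ρ` and integration by parts, one has
`((p-1)N/2 - 2)·g(s) ≤ (1/2)I(s) + (p+1)E(v(·,s))`. -/
theorem stmt16 (N : ℕ) (hN : 1 ≤ N) (p : ℝ) (hp : 1 < p)
    (v : ℝ → EuclideanSpace ℝ (Fin N) → ℝ)
    (hsmooth : ContDiff ℝ (⊤ : ℕ∞) (fun q : ℝ × EuclideanSpace ℝ (Fin N) => v q.1 q.2))
    (hsol : IsRescaledSolution p v)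
    (hint1 : ∀ s : ℝ, 0 < s → Integrable (fun y => v s y ^ 2 * rho y))
    (hint2 : ∀ s : ℝ, 0 < s → Integrable (fun y => ‖gradient (v s) y‖ ^ 2 * rho y))
    (hint3 : ∀ s : ℝ, 0 < s →
      Integrable (fun y => (deriv (fun τ => v τ y) s) ^ 2 * rho y))
    (hint4 : ∀ s : ℝ, 0 < s → Integrable (fun y => |v s y| ^ (p + 1) * rho y))
    (g : ℝ → ℝ)
    (hgdef : ∀ s : ℝ, g s = (1/2) * ∫ y, v s y ^ 2 * rho y)
    (hgderiv : ∀ s : ℝ, 0 < s → HasDerivAt g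
      (∫ y, v s y * deriv (fun τ => v τ y) s * rho y) s)
    (hparts : ∀ s : ℝ, 0 < s →
      ∫ y, v s y * (lap (v s) y + (1/2) * ⟪y, gradient (v s) y⟫_ℝ) * rho y
        = -∫ y, ‖gradient (v s) y‖ ^ 2 * rho y) :
    ∀ s : ℝ, 0 < s →
      ((p - 1) * (N : ℝ) / 2 - 2) * g s
        ≤ (1/2) * (∫ y, (deriv (fun τ => v τ y) s) ^ 2 * rho y)
          + (p + 1) * entropy p (v s) := by
  intro s hs
  have hw : ContDiff ℝ 1 (v s) := by
    have : ContDiff ℝ (⊤ : ℕ∞) (v s) :=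
      hsmooth.comp (contDiff_const.prodMk contDiff_id : ContDiff ℝ (⊤ : ℕ∞)
        fun y : EuclideanSpace ℝ (Fin N) => (s, y))
    exact this.of_le (by exact_mod_cast le_top)
  have hvc : Continuous (v s) := hw.continuous
  have hdc : Continuous fun y => deriv (fun τ => v τ y) s := by
    have h1 : ∀ y, deriv (fun τ => v τ y) s
        = fderiv ℝ (fun q : ℝ × EuclideanSpace ℝ (Fin N) => v q.1 q.2) (s, y) (1, 0) := by
      intro y
      have hd := ((hsmooth.differentiable (by simp)) (s, y)).hasFDerivAt
      exact (hd.comp_hasDerivAt s ((hasDerivAt_id s).prodMk (hasDerivAt_const s y))).deriv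
    simp only [h1]
    exact ((hsmooth.continuous_fderiv (by simp)).comp
      (continuous_const.prodMk continuous_id)).clm_apply continuous_const
  have iB := hint1 s hs
  have iA := hint2 s hs
  have iI := hint3 s hs
  have iC : Integrable fun y => v s y ^ (p + 1) * rho y := by
    refine (hint4 s hs).mono' ?_ (.of_forall fun y => ?_)
    · exact ((hvc.rpow_const fun _ => Or.inr (by linarith)).mul
        continuous_rho).aestronglyMeasurable
    · rw [Real.norm_eq_abs, abs_mul, abs_of_pos (rho_pos y)]
      exact mul_le_mul_of_nonneg_right (Real.abs_rpow_le_abs_rpow _ _) (rho_pos y).le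
  have iG := integrable_mul_mul_rho hvc hdc iB iI
  have hp1 : p - 1 ≠ 0 := by linarith
  have hp2 : p + 1 ≠ 0 := by linarith
  have hpoin := integral_sq_le_integral_norm_sq_gradient hw iB iA
  have hE : entropy p (v s) = (1 / 2) * (∫ y, ‖gradient (v s) y‖ ^ 2 * rho y)
      - (1 / (2 * (p - 1))) * (∫ y, v s y ^ 2 * rho y)
      - (1 / (p + 1)) * ∫ y, v s y ^ (p + 1) * rho y := by
    have iAB : Integrable fun y => 1 / 2 * (‖gradient (v s) y‖ ^ 2 * rho y)
        - 1 / (2 * (p - 1)) * (v s y ^ 2 * rho y) := (iA.const_mul _).sub (iB.const_mul _)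
    rw [← integral_const_mul, ← integral_const_mul, ← integral_const_mul,
      ← integral_sub (iA.const_mul _) (iB.const_mul _),
      ← integral_sub iAB (iC.const_mul _)]
    refine integral_congr_ae (.of_forall fun y => ?_)
    ring
  have hG : -(∫ y, ‖gradient (v s) y‖ ^ 2 * rho y)
      = (∫ y, v s y * deriv (fun τ => v τ y) s * rho y)
        - (1 / (p - 1)) * (∫ y, v s y ^ 2 * rho y) - ∫ y, v s y ^ (p + 1) * rho y := by
    have iGB : Integrable fun y => v s y * deriv (fun τ => v τ y) s * rho y
        - 1 / (p - 1) * (v s y ^ 2 * rho y) := iG.sub (iB.const_mul _)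
    rw [← hparts s hs, ← integral_const_mul, ← integral_sub iG (iB.const_mul _),
      ← integral_sub iGB iC]
    refine integral_congr_ae (.of_forall fun y => ?_)
    simp only
    rw [hsol y s hs, ← mul_rpow_self hp]
    ring
  have hY : (∫ y, v s y * deriv (fun τ => v τ y) s * rho y)
      ≤ (1 / 2) * (∫ y, v s y ^ 2 * rho y)
        + (1 / 2) * ∫ y, (deriv (fun τ => v τ y) s) ^ 2 * rho y := by
    rw [← integral_const_mul, ← integral_const_mul,
      ← integral_add (iB.const_mul _) (iI.const_mul _)]
    refine integral_mono iG ((iB.const_mul _).add (iI.const_mul _)) fun y => ?_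
    have := mul_nonneg (sq_nonneg (v s y - deriv (fun τ => v τ y) s)) (rho_pos y).le
    simp only
    nlinarith
  rw [hgdef, hE]
  generalize (∫ y, ‖gradient (v s) y‖ ^ 2 * rho y) = A at *
  generalize (∫ y, v s y ^ 2 * rho y) = B at *
  generalize (∫ y, v s y ^ (p + 1) * rho y) = C at *
  have hid : (p + 1) * (1 / 2 * A - 1 / (2 * (p - 1)) * B - 1 / (p + 1) * C)
      = (p - 1) / 2 * A - B / 2 - (-A + (1 / (p - 1)) * B + C) := by
    field_simp
    ring
  have hmul := mul_le_mul_of_nonneg_left hpoin (by linarith : 0 ≤ (p - 1) / 2)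
  rw [hid]
  linarith
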